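/- For every positive integer k there exists a connected twin-free subcubic graph G on n = 8k+2 vertices satisfying γ^LD(G) = n/2. -/

import Mathlib

open SimpleGraph

/-- The closed neighbourhood `N[v] = N(v) ∪ {v}` of a vertex. -/
def closedNbhd {V : Type*} (G : SimpleGraph V) (v : V) : Set V :=
  insert v (G.neighborSet v)

/-- The degree of a vertex, as the cardinality of its open neighbourhood. -/
noncomputable def deg {V : Type*} (G : SimpleGraph V) (v : V) : ℕ :=
  (G.neighborSet v).ncard

/-- `S` is a dominating set: every vertex has a member of `S` in its closed neighbourhood. -/
def IsDominating {V : Type*} (G : SimpleGraph V) (S : Set V) : Prop :=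
  ∀ v : V, (closedNbhd G v ∩ S).Nonempty

/-- `S` is a locating-dominating set: it dominates and separates all pairs of
vertices outside `S` by their closed neighbourhoods intersected with `S`. -/
def IsLDSet {V : Type*} (G : SimpleGraph V) (S : Set V) : Prop :=
  IsDominating G S ∧
    ∀ u ∉ S, ∀ v ∉ S, u ≠ v → closedNbhd G u ∩ S ≠ closedNbhd G v ∩ S

/-- The location-domination number `γ^LD(G)`. -/
noncomputable def ldNum {V : Type*} (G : SimpleGraph V) : ℕ :=
  sInf {k : ℕ | ∃ S : Set V, IsLDSet G S ∧ S.ncard = k}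

/-- A graph is subcubic if every vertex has degree at most 3. -/
def Subcubic {V : Type*} (G : SimpleGraph V) : Prop :=
  ∀ v : V, deg G v ≤ 3

/-- `u` and `v` are open twins: distinct vertices with the same open neighbourhood. -/
def OpenTwins {V : Type*} (G : SimpleGraph V) (u v : V) : Prop :=
  u ≠ v ∧ G.neighborSet u = G.neighborSet v

/-- `u` and `v` are closed twins: distinct vertices with the same closed neighbourhood. -/
def ClosedTwins {V : Type*} (G : SimpleGraph V) (u v : V) : Prop :=
  u ≠ v ∧ closedNbhd G u = closedNbhd G v

/-- A graph is twin-free if it has neither open twins nor closed twins. -/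
def TwinFree {V : Type*} (G : SimpleGraph V) : Prop :=
  (¬ ∃ u v : V, OpenTwins G u v) ∧ (¬ ∃ u v : V, ClosedTwins G u v)

/-- The comb on `2 * m` vertices: a path on `0, …, m - 1` with a pendant vertex `m + i`
attached to each path vertex `i`. -/
def comb (m : ℕ) : SimpleGraph (Fin (2 * m)) where
  Adj u v := (u.1 < m ∧ v.1 < m ∧ (u.1 + 1 = v.1 ∨ v.1 + 1 = u.1)) ∨ u.1 + m = v.1 ∨ v.1 + m = u.1
  symm := ⟨fun u v h => by omega⟩
  loopless := ⟨fun u h => by have := u.2; omega⟩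

lemma comb_adj {m : ℕ} {u v : Fin (2 * m)} : (comb m).Adj u v ↔
    (u.1 < m ∧ v.1 < m ∧ (u.1 + 1 = v.1 ∨ v.1 + 1 = u.1)) ∨ u.1 + m = v.1 ∨ v.1 + m = u.1 :=
  Iff.rfl

lemma comb_connected {m : ℕ} (hm : 0 < m) : (comb m).Connected := by
  have path : ∀ i (hi : i < m), (comb m).Reachable ⟨0, by omega⟩ ⟨i, by omega⟩ := by
    intro i
    induction i with
    | zero => exact fun _ => Reachable.refl _
    | succ i ih =>
      intro hi
      refine (ih (by omega)).trans (Adj.reachable ?_)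
      rw [comb_adj]
      dsimp only
      omega
  refine ((comb m).connected_iff_exists_forall_reachable).2 ⟨⟨0, by omega⟩, fun v => ?_⟩
  by_cases hv : v.1 < m
  · exact path v.1 hv
  · have := v.2
    refine (path (v.1 - m) (by omega)).trans (Adj.reachable ?_)
    rw [comb_adj]
    dsimp only
    omega

lemma comb_twinFree {m : ℕ} (hm : 2 ≤ m) : TwinFree (comb m) := by
  constructor
  · rintro ⟨u, v, hne, h⟩
    have hu := u.2
    have hv := v.2
    have hne' : u.1 ≠ v.1 := fun e => hne (Fin.ext e)
    have key : ∀ w, (comb m).Adj u w ↔ (comb m).Adj v w := fun w => Set.ext_iff.1 h w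
    simp only [comb_adj] at key
    by_cases hum : u.1 < m
    · have := key ⟨u.1 + m, by omega⟩
      dsimp only at this
      omega
    · by_cases hvm : v.1 < m
      · have := key ⟨v.1 + m, by omega⟩
        dsimp only at this
        omega
      · have := key ⟨u.1 - m, by omega⟩
        dsimp only at this
        omega
  · rintro ⟨u, v, hne, h⟩
    have hu := u.2
    have hv := v.2
    have hne' : u.1 ≠ v.1 := fun e => hne (Fin.ext e)
    have key : ∀ w, (w = u ∨ (comb m).Adj u w) ↔ (w = v ∨ (comb m).Adj v w) :=
      fun w => Set.ext_iff.1 h w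
    simp only [comb_adj, Fin.ext_iff] at key
    have hadj := key u
    have next : ∀ i < m, ∃ w < m, i + 1 = w ∨ w + 1 = i := fun i hi => by
      by_cases h : i + 1 < m
      · exact ⟨i + 1, h, Or.inl rfl⟩
      · exact ⟨i - 1, by omega, by omega⟩
    by_cases hum : u.1 < m
    · by_cases hvm : v.1 < m
      · have := key ⟨u.1 + m, by omega⟩
        dsimp only at this
        omega
      · obtain ⟨w, hwm, hw⟩ := next u.1 hum
        have := key ⟨w, by omega⟩
        dsimp only at this
        omega
    · obtain ⟨w, hwm, hw⟩ := next (u.1 - m) (by omega)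
      have := key ⟨w, by omega⟩
      dsimp only at this
      omega

lemma comb_subcubic (m : ℕ) : Subcubic (comb m) := by
  intro v
  have hsub : Fin.val '' (comb m).neighborSet v ⊆
      (({v.1 - 1, v.1 + 1, if v.1 < m then v.1 + m else v.1 - m} : Finset ℕ) : Set ℕ) := by
    rintro _ ⟨w, hw, rfl⟩
    rw [mem_neighborSet, comb_adj] at hw
    have := w.2
    simp only [Finset.coe_insert, Finset.coe_singleton, Set.mem_insert_iff,
      Set.mem_singleton_iff]
    split_ifs <;> omega
  calc deg (comb m) v = (Fin.val '' (comb m).neighborSet v).ncard :=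
        (Set.ncard_image_of_injective _ Fin.val_injective).symm
    _ ≤ _ := Set.ncard_le_ncard hsub (Finset.finite_toSet _)
    _ ≤ 3 := by
        rw [Set.ncard_coe_finset]
        exact Finset.card_le_three

/-- The closed neighbourhoods of the pendant vertices are disjoint. -/
lemma le_ncard_of_isDominating_comb {m : ℕ} {S : Set (Fin (2 * m))}
    (hS : IsDominating (comb m) S) : m ≤ S.ncard := by
  choose f hf using fun i : Fin m => hS ⟨m + i.1, by omega⟩
  have hval : ∀ i, (f i).1 = m + i.1 ∨ (f i).1 = i.1 := by
    intro i
    have h : f i = _ ∨ (comb m).Adj _ (f i) := (hf i).1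
    rw [comb_adj, Fin.ext_iff] at h
    have := (f i).2
    dsimp only at h
    omega
  have hinj : Function.Injective f := by
    intro i j h
    have hi := hval i
    have hj := hval j
    rw [h] at hi
    ext
    omega
  calc m = (Set.range f).ncard := by
        rw [← Set.image_univ, Set.ncard_image_of_injective _ hinj, Set.ncard_univ, Nat.card_fin]
    _ ≤ S.ncard := Set.ncard_le_ncard (by rintro _ ⟨i, rfl⟩; exact (hf i).2) S.toFinite

lemma isLDSet_comb_path (m : ℕ) : IsLDSet (comb m) {v | v.1 < m} := by
  constructor
  · intro v
    by_cases hv : v.1 < m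
    · exact ⟨v, Set.mem_insert _ _, hv⟩
    · have := v.2
      refine ⟨⟨v.1 - m, by omega⟩, Or.inr ?_, by simp only [Set.mem_ofPred_eq]; omega⟩
      rw [mem_neighborSet, comb_adj]
      dsimp only
      omega
  · intro u hu v hv hne h
    simp only [Set.mem_ofPred_eq] at hu hv
    have hne' : u.1 ≠ v.1 := fun e => hne (Fin.ext e)
    have hu2 := u.2
    have key : ((_ = u ∨ (comb m).Adj u _) ∧ _ < m) ↔ ((_ = v ∨ (comb m).Adj v _) ∧ _ < m) :=
      Set.ext_iff.1 h ⟨u.1 - m, by omega⟩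
    simp only [comb_adj, Fin.ext_iff] at key
    omega

lemma ncard_comb_path (m : ℕ) : {v : Fin (2 * m) | v.1 < m}.ncard = m := by
  have h : Fin.val '' {v : Fin (2 * m) | v.1 < m} = (Finset.range m : Set ℕ) := by
    ext i
    simp only [Set.mem_image, Set.mem_ofPred_eq, Finset.coe_range, Set.mem_Iio]
    exact ⟨by rintro ⟨v, hv, rfl⟩; exact hv, fun hi => ⟨⟨i, by omega⟩, hi, rfl⟩⟩
  rw [← Set.ncard_image_of_injective _ Fin.val_injective, h, Set.ncard_coe_finset,
    Finset.card_range]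

lemma ldNum_comb (m : ℕ) : ldNum (comb m) = m := by
  refine IsLeast.csInf_eq ⟨⟨_, isLDSet_comb_path m, ncard_comb_path m⟩, ?_⟩
  rintro _ ⟨S, hS, rfl⟩
  exact le_ncard_of_isDominating_comb hS.1

/-- For every positive `k` there is a connected twin-free subcubic graph
on `n = 8k + 2` vertices whose location-domination number equals `n/2 = 4k + 1`. -/
theorem stmt13 (k : ℕ) (hk : 0 < k) :
    ∃ G : SimpleGraph (Fin (8 * k + 2)), G.Connected ∧ TwinFree G ∧ Subcubic G ∧
      ldNum G = 4 * k + 1 := by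
  have hn : 8 * k + 2 = 2 * (4 * k + 1) := by ring
  rw [hn]
  exact ⟨comb (4 * k + 1), comb_connected (by omega), comb_twinFree (by omega),
    comb_subcubic _, ldNum_comb _⟩
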